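/- No group of order 30 is generated by an element of order 2 together with an element of order 3: for every group G with |G| = 30 there do not exist τ, σ ∈ G with orderOf τ = 2, orderOf σ = 3, and the subgroup generated by {τ, σ} equal to all of G. -/

import Mathlib

/-- In a group of order `15`, every subgroup of order `3` is characteristic. -/
theorem characteristic_of_card_eq_three {H : Type*} [Group H] (hH : Nat.card H = 15)
    (K : Subgroup H) (hK : Nat.card K = 3) : K.Characteristic := by
  have : Finite H := Nat.finite_of_card_ne_zero (by omega)
  have : Fact (Nat.Prime 3) := ⟨Nat.prime_three⟩
  have hfac : Nat.factorization 15 3 = 1 := by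
    rw [show 15 = 3 * 5 from rfl, Nat.factorization_mul (by norm_num) (by norm_num),
      Nat.prime_three.factorization, Nat.Prime.factorization (by norm_num : Nat.Prime 5)]
    simp
  let P : Sylow 3 H := Sylow.ofCard K (by rw [hK, hH, hfac, pow_one])
  have hindex : P.index = 5 := by
    have h := K.card_mul_index
    change K.index = 5
    rw [hK, hH] at h
    omega
  have hdvd : Nat.card (Sylow 3 H) ∣ 5 := hindex ▸ P.card_dvd_index
  have hmod : Nat.card (Sylow 3 H) ≡ 1 [MOD 3] := card_sylow_modEq_one 3 H
  have hone : Nat.card (Sylow 3 H) = 1 := by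
    rcases (Nat.dvd_prime (by norm_num)).mp hdvd with h | h
    · exact h
    · rw [h] at hmod
      exact absurd hmod (by decide)
  have : Subsingleton (Sylow 3 H) := (Nat.card_eq_one_iff_unique.mp hone).1
  exact P.characteristic_of_subsingleton

/-- In a group of order `30`, every element of order `3` generates a normal subgroup. -/
theorem zpowers_normal_of_card_eq_thirty {G : Type*} [Group G] (hG : Nat.card G = 30) {σ : G}
    (hσ : orderOf σ = 3) : (Subgroup.zpowers σ).Normal := by
  have : Finite G := Nat.finite_of_card_ne_zero (by omega)
  have : Fact (Nat.Prime 2) := ⟨Nat.prime_two⟩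
  have hfac : Nat.factorization 30 2 = 1 := by
    rw [show 30 = 2 * 15 from rfl, Nat.factorization_mul (by norm_num) (by norm_num),
      Nat.prime_two.factorization]
    simp [Nat.factorization_eq_zero_of_not_dvd (show ¬ 2 ∣ 15 by norm_num)]
  have hmin : (Nat.card G).minFac = 2 := by rw [hG]; norm_num
  obtain ⟨P⟩ : Nonempty (Sylow 2 G) := inferInstance
  have hP : Nat.card P = 2 := by rw [P.card_eq_multiplicity, hG, hfac, pow_one]
  have hcyc : IsCyclic P := isCyclic_of_prime_card hP
  let f := MonoidHom.transferSylow P (hcyc.normalizer_le_centralizer hmin)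
  have hker : Nat.card f.ker = 15 := by
    have h := (IsCyclic.isComplement' hmin hcyc).card_mul_card
    change Nat.card f.ker * Nat.card P = _ at h
    rw [hP, hG] at h
    omega
  have hmem : σ ∈ f.ker := by
    have h2 : orderOf (f σ) ∣ 2 := (orderOf_dvd_natCard (f σ)).trans (dvd_of_eq hP)
    have h3 : orderOf (f σ) ∣ 3 := hσ ▸ orderOf_map_dvd f σ
    exact orderOf_eq_one_iff.mp (Nat.dvd_one.mp (Nat.dvd_gcd h2 h3))
  have hchar := characteristic_of_card_eq_three hker (Subgroup.zpowers ⟨σ, hmem⟩)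
    (by rw [Nat.card_zpowers, Subgroup.orderOf_mk, hσ])
  have hmap : (Subgroup.zpowers (⟨σ, hmem⟩ : f.ker)).map f.ker.subtype = Subgroup.zpowers σ :=
    MonoidHom.map_zpowers _ _
  rw [← hmap]
  infer_instance

theorem stmt_10 (G : Type) [Group G] (hG : Nat.card G = 30) :
    ¬ ∃ τ σ : G, orderOf τ = 2 ∧ orderOf σ = 3 ∧
      Subgroup.closure ({τ, σ} : Set G) = ⊤ := by
  rintro ⟨τ, σ, hτ, hσ, hgen⟩
  have hnormal := zpowers_normal_of_card_eq_thirty hG hσ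
  have hsup : Subgroup.zpowers τ ⊔ Subgroup.zpowers σ = ⊤ := by
    rw [← hgen, Set.insert_eq, Subgroup.closure_union, Subgroup.zpowers_eq_closure,
      Subgroup.zpowers_eq_closure]
  have hindex : (Subgroup.zpowers σ).index ∣ 2 := by
    rw [← Subgroup.relIndex_top_right, ← hsup, Subgroup.relIndex_sup_right, ← hτ,
      ← Nat.card_zpowers]
    exact Subgroup.relIndex_dvd_card _ _
  have hcard := (Subgroup.zpowers σ).card_mul_index
  rw [Nat.card_zpowers, hσ, hG] at hcard
  have := Nat.le_of_dvd two_pos hindex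
  omega
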